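/- Let Z be a standard normal random variable, let ȳ ∈ ℝ, and define the reflected random variable R := ȳ + |Z − ȳ|. Define M̄(y) := M_Z(y) + M_Z(2ȳ − y) − 2ȳ · F_Z(2ȳ − y) for y ≥ ȳ. Then for all real numbers a, b with ȳ ≤ a ≤ b, the truncated first moment of the reflected variable satisfies E[ R · 1{a < R ≤ b} ] = M̄(b) − M̄(a). -/

import Mathlib

open MeasureTheory ProbabilityTheory

/-- standard normal density `φ(t) = exp(−t²/2)/√(2π)` -/
noncomputable def stdPhi (t : ℝ) : ℝ := Real.exp (-t ^ 2 / 2) / Real.sqrt (2 * Real.pi)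

/-- standard normal cumulative distribution function `F_Z` -/
noncomputable def stdCDF (z : ℝ) : ℝ := ∫ t in Set.Iic z, stdPhi t

/-- first lower partial expectation `M_Z(z) = E[Z·1{Z < z}]` of a standard normal -/
noncomputable def stdM (z : ℝ) : ℝ := ∫ t in Set.Iio z, t * stdPhi t

/-- reflected lower partial expectation
`M̄(y) = M_Z(y) + M_Z(2ȳ − y) − 2ȳ·F_Z(2ȳ − y)` -/
noncomputable def stdMRefl (ybar y : ℝ) : ℝ :=
  stdM y + stdM (2 * ybar - y) - 2 * ybar * stdCDF (2 * ybar - y)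

theorem gaussianPDFReal_zero_one_eq_stdPhi : gaussianPDFReal 0 1 = stdPhi := by
  ext t
  simp [gaussianPDFReal, stdPhi, div_eq_inv_mul]

theorem integrable_stdPhi : Integrable stdPhi := by
  rw [← gaussianPDFReal_zero_one_eq_stdPhi]
  exact integrable_gaussianPDFReal 0 1

theorem integrable_mul_stdPhi : Integrable fun t => t * stdPhi t := by
  have h := (integrable_mul_exp_neg_mul_sq (b := 1 / 2) (by norm_num)).div_const
    (Real.sqrt (2 * Real.pi))
  refine h.congr (Filter.Eventually.of_forall fun t => ?_)
  simp only [stdPhi]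
  rw [mul_div_assoc, show -(1 / 2) * t ^ 2 = -t ^ 2 / 2 by ring]

theorem stdCDF_sub_stdCDF (x y : ℝ) : stdCDF y - stdCDF x = ∫ t in x..y, stdPhi t :=
  intervalIntegral.integral_Iic_sub_Iic integrable_stdPhi.integrableOn
    integrable_stdPhi.integrableOn

theorem stdM_sub_stdM (x y : ℝ) : stdM y - stdM x = ∫ t in x..y, t * stdPhi t := by
  simp only [stdM, ← integral_Iic_eq_integral_Iio]
  exact intervalIntegral.integral_Iic_sub_Iic integrable_mul_stdPhi.integrableOn
    integrable_mul_stdPhi.integrableOn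

/-- The reflected variable falls in `(a, b]` either directly or from the mirror image
`[2ȳ - b, 2ȳ - a)` of that interval. -/
theorem ite_reflected_eq_indicator_add_indicator (w : ℝ → ℝ) {ybar a : ℝ} (b t : ℝ)
    (ha : ybar ≤ a) :
    w t * (if a < ybar + |t - ybar| ∧ ybar + |t - ybar| ≤ b then ybar + |t - ybar| else 0)
      = (Set.Ioc a b).indicator (fun s => s * w s) t
        + (Set.Ico (2 * ybar - b) (2 * ybar - a)).indicator
            (fun s => (2 * ybar - s) * w s) t := by
  simp only [Set.indicator_apply, Set.mem_Ioc, Set.mem_Ico]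
  rcases le_total ybar t with h | h
  · rw [abs_of_nonneg (by linarith)]
    rw [if_neg (c := 2 * ybar - b ≤ t ∧ t < 2 * ybar - a) (by rintro ⟨-, hab⟩; linarith)]
    rw [show ybar + (t - ybar) = t by ring]
    split_ifs <;> ring
  · rw [abs_of_nonpos (by linarith)]
    rw [if_neg (c := a < t ∧ t ≤ b) (by rintro ⟨hab, -⟩; linarith)]
    rw [show ybar + -(t - ybar) = 2 * ybar - t by ring]
    have hiff : (a < 2 * ybar - t ∧ 2 * ybar - t ≤ b)
        ↔ (2 * ybar - b ≤ t ∧ t < 2 * ybar - a) := by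
      constructor <;> rintro ⟨h₁, h₂⟩ <;> constructor <;> linarith
    simp only [hiff]
    split_ifs <;> ring

/-- **Truncated first moment of the reflected standard normal.** For a standard normal `Z`,
`R := ȳ + |Z − ȳ|`, and `ȳ ≤ a ≤ b`:
`E[R·1{a < R ≤ b}] = M̄(b) − M̄(a)` where `M̄(y) = M_Z(y) + M_Z(2ȳ − y) − 2ȳF_Z(2ȳ − y)`. -/
theorem reflected_gaussian_truncated_first_moment
    {Ω : Type*} [MeasurableSpace Ω] (P : Measure Ω) [IsProbabilityMeasure P]
    (Z : Ω → ℝ) (hZm : Measurable Z) (hZ : P.map Z = gaussianReal 0 1)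
    (ybar a b : ℝ) (ha : ybar ≤ a) (hab : a ≤ b) :
    ∫ ω, (if a < ybar + |Z ω - ybar| ∧ ybar + |Z ω - ybar| ≤ b
            then ybar + |Z ω - ybar| else 0) ∂P
      = stdMRefl ybar b - stdMRefl ybar a := by
  have hmeas : Measurable fun t : ℝ =>
      if a < ybar + |t - ybar| ∧ ybar + |t - ybar| ≤ b then ybar + |t - ybar| else 0 := by
    have hR : Measurable fun t : ℝ => ybar + |t - ybar| := by fun_prop
    exact Measurable.ite ((measurableSet_lt measurable_const hR).inter
      (measurableSet_le hR measurable_const)) hR measurable_const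
  have hrefl : Integrable fun t => (2 * ybar - t) * stdPhi t := by
    simp only [sub_mul]
    exact (integrable_stdPhi.const_mul _).sub integrable_mul_stdPhi
  rw [← integral_map (φ := Z) hZm.aemeasurable hmeas.aestronglyMeasurable, hZ,
    integral_gaussianReal_eq_integral_smul one_ne_zero, gaussianPDFReal_zero_one_eq_stdPhi]
  simp only [smul_eq_mul, ite_reflected_eq_indicator_add_indicator stdPhi b _ ha]
  rw [integral_add (integrable_mul_stdPhi.indicator measurableSet_Ioc)
      (hrefl.indicator measurableSet_Ico),
    integral_indicator measurableSet_Ioc, integral_indicator measurableSet_Ico,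
    integral_Ico_eq_integral_Ioc, ← intervalIntegral.integral_of_le hab,
    ← intervalIntegral.integral_of_le (by linarith : 2 * ybar - b ≤ 2 * ybar - a)]
  simp only [sub_mul _ _ (stdPhi _)]
  rw [intervalIntegral.integral_sub (integrable_stdPhi.const_mul _).intervalIntegrable
      integrable_mul_stdPhi.intervalIntegrable, intervalIntegral.integral_const_mul,
    ← stdM_sub_stdM, ← stdM_sub_stdM, ← stdCDF_sub_stdCDF]
  simp only [stdMRefl]
  ring
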